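/- Let B and C be abelian groups and let f : B → C and g : C → B be group homomorphisms such that the composite g ∘ f equals multiplication by a positive integer d on B. If the quotient C_nd = C/C_div of C by its maximal divisible subgroup is torsion of finite exponent, then the quotient B_nd = B/B_div of B by its maximal divisible subgroup is torsion of finite exponent. -/

import Mathlib

/-- The maximal divisible subgroup of an abelian group: the supremum of all
divisible subgroups. -/
def divisibleSubgroup (B : Type*) [AddCommGroup B] : AddSubgroup B :=
  sSup {D : AddSubgroup B | ∀ x ∈ D, ∀ n : ℕ, 0 < n → ∃ y ∈ D, n • y = x}

/-- A homomorphism maps the maximal divisible subgroup into the maximal divisible subgroup. -/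
theorem divisibleSubgroup_le_comap {B C : Type*} [AddCommGroup B] [AddCommGroup C] (g : C →+ B) :
    divisibleSubgroup C ≤ (divisibleSubgroup B).comap g := by
  refine sSup_le fun D hD => AddSubgroup.map_le_iff_le_comap.mp (le_sSup ?_)
  rintro _ ⟨x, hx, rfl⟩ n hn
  obtain ⟨y, hy, rfl⟩ := hD x hx n hn
  exact ⟨g y, ⟨y, hy, rfl⟩, (map_nsmul g n y).symm⟩

/-- If `g ∘ f = d` on `B` for some positive integer `d`, and `C/C_div` is
torsion of finite exponent, then `B/B_div` is torsion of finite exponent. -/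
theorem stmt4 (B C : Type*) [AddCommGroup B] [AddCommGroup C]
    (f : B →+ C) (g : C →+ B) (d : ℕ) (hd : 0 < d)
    (hgf : ∀ b : B, g (f b) = d • b)
    (hC : ∃ N : ℕ, 0 < N ∧ ∀ x : C ⧸ divisibleSubgroup C, N • x = 0) :
    ∃ N : ℕ, 0 < N ∧ ∀ x : B ⧸ divisibleSubgroup B, N • x = 0 := by
  obtain ⟨N, hN, h⟩ := hC
  refine ⟨d * N, Nat.mul_pos hd hN, fun x => ?_⟩
  induction x using QuotientAddGroup.induction_on with
  | H b =>
    have hmem : N • f b ∈ divisibleSubgroup C :=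
      (QuotientAddGroup.eq_zero_iff _).mp (h (f b : C ⧸ divisibleSubgroup C))
    have hg : g (N • f b) ∈ divisibleSubgroup B := divisibleSubgroup_le_comap g hmem
    rw [map_nsmul, hgf, ← mul_nsmul] at hg
    exact (QuotientAddGroup.eq_zero_iff _).mpr hg
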